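/- Let c ∈ ℝ, let q ∈ [0,1] be a constant, and let (p_n) be a sequence in [0,1] with n·p_n − log n → c. Then the probability that a digraph drawn from the random digraph model G(n, p_n, q) admits a Hamiltonian decomposition converges, as n → ∞, to e^{−2(1−q)e^{−c}}. -/

import Mathlib

open Finset Filter

/-- A matching in the bipartite representation of a digraph on `Fin n`:
a set of edges no two of which share a left endpoint or share a right endpoint. -/
def IsMatching (n : ℕ) (M : Finset (Fin n × Fin n)) : Prop :=
  ∀ e ∈ M, ∀ f ∈ M, (e.1 = f.1 ∨ e.2 = f.2) → e = f

/-- `M` is a maximum matching of the bipartite representation of the digraph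
with edge set `E`. -/
def IsMaxMatching (n : ℕ) (E M : Finset (Fin n × Fin n)) : Prop :=
  M ⊆ E ∧ IsMatching n M ∧ ∀ M' ⊆ E, IsMatching n M' → M'.card ≤ M.card

/-- The digraph `(V, M)` is a disjoint union of directed cycles and isolated
vertices: `M` is the graph of a permutation restricted to an invariant set `S`,
all vertices outside `S` being isolated. -/
def CyclesAndIsolated (n : ℕ) (M : Finset (Fin n × Fin n)) : Prop :=
  ∃ σ : Equiv.Perm (Fin n), ∃ S : Finset (Fin n),
    (∀ u ∈ S, σ u ∈ S) ∧ M = S.image fun u => (u, σ u)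

/-- A digraph is structurally diagonalizable if its bipartite representation has a
maximum matching `M` such that `(V, M)` is a disjoint union of directed cycles
and isolated vertices. -/
def StructurallyDiagonalizable (n : ℕ) (E : Finset (Fin n × Fin n)) : Prop :=
  ∃ M, IsMaxMatching n E M ∧ CyclesAndIsolated n M

/-- A Hamiltonian decomposition: a spanning subgraph that is a disjoint union of
directed cycles covering all `n` vertices, i.e. the functional graph of a
permutation contained in `E`. -/
def HasHamiltonianDecomposition (n : ℕ) (E : Finset (Fin n × Fin n)) : Prop :=
  ∃ σ : Equiv.Perm (Fin n), ∀ u, (u, σ u) ∈ E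

/-- A consistent matching of the bipartite representation of `E`: a matching whose
set of left endpoints equals its set of right endpoints. -/
def IsConsistentMatching (n : ℕ) (E M : Finset (Fin n × Fin n)) : Prop :=
  M ⊆ E ∧ IsMatching n M ∧ M.image Prod.fst = M.image Prod.snd

/-- Neighborhood, on the right side, of a set `I` of left vertices of `B(G)`. -/
def leftNbhd (n : ℕ) (E : Finset (Fin n × Fin n)) (I : Finset (Fin n)) :
    Finset (Fin n) :=
  Finset.univ.filter fun v => ∃ u ∈ I, (u, v) ∈ E

/-- Neighborhood, on the left side, of a set `I` of right vertices of `B(G)`. -/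
def rightNbhd (n : ℕ) (E : Finset (Fin n × Fin n)) (I : Finset (Fin n)) :
    Finset (Fin n) :=
  Finset.univ.filter fun u => ∃ v ∈ I, (u, v) ∈ E

/-- Membership in `F_k^n`: (1) some subset `I` of one side of `B(G)` has `|I| = k`
and `|N(I)| = k - 1`; (2) no subset `J` of either side with `|J| < k` satisfies
`|N(J)| = |J| - 1`. -/
def memF (n k : ℕ) (E : Finset (Fin n × Fin n)) : Prop :=
  (∃ I : Finset (Fin n), I.card = k ∧
      ((leftNbhd n E I).card + 1 = k ∨ (rightNbhd n E I).card + 1 = k)) ∧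
  ∀ J : Finset (Fin n), J.card < k →
      (leftNbhd n E J).card + 1 ≠ J.card ∧ (rightNbhd n E J).card + 1 ≠ J.card

/-- Membership in `L_k^n`: the bipartite representation of `E` admits a maximum
matching of size `n - k` that decomposes the digraph into disjoint cycles and
isolated vertices. -/
def memL (n k : ℕ) (E : Finset (Fin n × Fin n)) : Prop :=
  ∃ M, IsMaxMatching n E M ∧ M.card = n - k ∧ CyclesAndIsolated n M

/-- The probability, under the random digraph model `G(n, p, q)` (each non-loop
edge present independently with probability `p`, each self-loop with
probability `q`), that the sampled digraph lies in the set `A`. -/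
noncomputable def digraphProb (n : ℕ) (p q : ℝ)
    (A : Set (Finset (Fin n × Fin n))) : ℝ :=
  ∑ E : Finset (Fin n × Fin n),
    Set.indicator A (fun E =>
      (∏ e ∈ E, if e.1 = e.2 then q else p) *
      ∏ e ∈ Finset.univ \ E, if e.1 = e.2 then 1 - q else 1 - p) E

section BernoulliWeight

variable {α β : Type*} [Fintype α] [DecidableEq α] [DecidableEq β]

/-- The probability of the outcome `A` when each `a` is included independently with
probability `w a`. -/
def bernoulliWeight (w : α → ℝ) (A : Finset α) : ℝ :=
  ∏ a, if a ∈ A then w a else 1 - w a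

/-- The set of in-neighbours of `v` in the digraph with edge set `E`. -/
def inNbhd (E : Finset (α × β)) (v : β) : Finset α :=
  univ.filter fun u => (u, v) ∈ E

@[simp] lemma mem_inNbhd {E : Finset (α × β)} {u : α} {v : β} :
    u ∈ inNbhd E v ↔ (u, v) ∈ E := by simp [inNbhd]

lemma bernoulliWeight_nonneg {w : α → ℝ} (hw : ∀ a, w a ∈ Set.Icc (0 : ℝ) 1)
    (A : Finset α) : 0 ≤ bernoulliWeight w A :=
  prod_nonneg fun a _ => by
    split_ifs
    · exact (hw a).1
    · exact sub_nonneg.2 (hw a).2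

lemma bernoulliWeight_eq (w : α → ℝ) (A : Finset α) :
    bernoulliWeight w A = (∏ a ∈ A, w a) * ∏ a ∈ univ \ A, (1 - w a) := by
  rw [bernoulliWeight, prod_ite]
  congr 2
  · ext; simp
  · ext; simp

lemma sum_bernoulliWeight_mul_disjoint (w : α → ℝ) (S : Finset α) :
    ∑ A, bernoulliWeight w A * (if Disjoint A S then 1 else 0) = ∏ a ∈ S, (1 - w a) := by
  have h := Fintype.prod_add (fun a => if a ∈ S then 0 else w a) (fun a => 1 - w a)
  have h' : ∏ a, ((if a ∈ S then 0 else w a) + (1 - w a)) = ∏ a ∈ S, (1 - w a) := by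
    rw [← Finset.prod_subset (subset_univ S)]
    · exact prod_congr rfl fun a ha => by simp [ha]
    · intro a _ ha; simp [ha]
  rw [← h', h]
  refine sum_congr rfl fun A _ => ?_
  rw [bernoulliWeight_eq, ← compl_eq_univ_sdiff]
  by_cases hd : Disjoint A S
  · rw [if_pos hd, mul_one]
    congr 1
    exact prod_congr rfl fun a ha => by simp [Finset.disjoint_left.1 hd ha]
  · rw [if_neg hd, mul_zero]
    obtain ⟨a, ha, hS⟩ := Finset.not_disjoint_iff.1 hd
    rw [prod_eq_zero ha (by simp [hS]), zero_mul]

lemma sum_bernoulliWeight_mul_subset (w : α → ℝ) (S : Finset α) :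
    ∑ A, bernoulliWeight w A * (if S ⊆ A then 1 else 0) = ∏ a ∈ S, w a := by
  have h := Fintype.prod_add w (fun a => if a ∈ S then 0 else 1 - w a)
  have h' : ∏ a, (w a + (if a ∈ S then 0 else 1 - w a)) = ∏ a ∈ S, w a := by
    rw [← Finset.prod_subset (subset_univ S)]
    · exact prod_congr rfl fun a ha => by simp [ha]
    · intro a _ ha; simp [ha]
  rw [← h', h]
  refine sum_congr rfl fun A _ => ?_
  rw [bernoulliWeight_eq, ← compl_eq_univ_sdiff]
  by_cases hd : S ⊆ A
  · rw [if_pos hd, mul_one]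
    congr 1
    refine prod_congr rfl fun a ha => ?_
    rw [if_neg fun h => mem_compl.1 ha (hd h)]
  · rw [if_neg hd, mul_zero]
    obtain ⟨a, hS, ha⟩ := Finset.not_subset.1 hd
    rw [prod_eq_zero (mem_compl.2 ha) (by simp [hS]), mul_zero]

/-- Distinct columns of a random bipartite graph are independent. -/
lemma sum_bernoulliWeight_mul_prod_inNbhd [Fintype β] (w : α × β → ℝ) (f : β → Finset α → ℝ) :
    ∑ E, bernoulliWeight w E * ∏ v, f v (inNbhd E v) =
      ∏ v, ∑ A, bernoulliWeight (fun u => w (u, v)) A * f v A := by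
  rw [prod_univ_sum, Fintype.piFinset_univ]
  let e : Finset (α × β) ≃ (β → Finset α) :=
    { toFun := inNbhd
      invFun := fun g => univ.filter fun x => x.1 ∈ g x.2
      left_inv := fun E => by ext; simp
      right_inv := fun g => by ext; simp }
  refine Fintype.sum_equiv e _ _ fun E => ?_
  rw [prod_mul_distrib]
  congr 1
  rw [bernoulliWeight, Fintype.prod_prod_type_right]
  simp [e, bernoulliWeight]

/-- Reversing all edges preserves probabilities. -/
lemma sum_bernoulliWeight_map_swap (w : α × α → ℝ) (hw : ∀ x, w x.swap = w x)
    (g : Finset (α × α) → ℝ) :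
    ∑ E, bernoulliWeight w E * g (E.map (Equiv.prodComm α α).toEmbedding) =
      ∑ E, bernoulliWeight w E * g E := by
  refine Fintype.sum_equiv (Equiv.prodComm α α).finsetCongr _ _ fun E => ?_
  congr 1
  rw [bernoulliWeight, bernoulliWeight]
  refine Fintype.prod_equiv (Equiv.prodComm α α) _ _ fun x => ?_
  simp [hw]

end BernoulliWeight

section Obstruction

/-- `I` is a set of `k` rows whose neighbourhood lies in a set `J` of `k - 1` columns, each of
which meets `I` at least twice. -/
def IsObstruction {n : ℕ} (E : Finset (Fin n × Fin n)) (I J : Finset (Fin n)) : Prop :=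
  (∀ v ∉ J, Disjoint (inNbhd E v) I) ∧
    ∀ v ∈ J, ∃ u ∈ I, ∃ u' ∈ I, u ≠ u' ∧ (u, v) ∈ E ∧ (u', v) ∈ E

/-- Some set of `k` rows carries an obstruction. -/
def HasObstruction {n : ℕ} (E : Finset (Fin n × Fin n)) (k : ℕ) : Prop :=
  ∃ I J : Finset (Fin n), I.card = k ∧ J.card + 1 = k ∧ IsObstruction E I J

/-- By Hall: without a Hamiltonian decomposition, some set has a small neighbourhood. -/
lemma exists_deficient {n : ℕ} {E : Finset (Fin n × Fin n)}
    (h : ¬ HasHamiltonianDecomposition n E) :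
    ∃ I : Finset (Fin n), (leftNbhd n E I).card < I.card := by
  by_contra! hc
  have hall := (Finset.all_card_le_biUnion_card_iff_exists_injective
    (fun u : Fin n => univ.filter fun v => (u, v) ∈ E)).1 fun s => by
      refine (hc s).trans (card_le_card fun v hv => ?_)
      simpa [leftNbhd] using hv
  obtain ⟨f, hf, hfE⟩ := hall
  exact h ⟨Equiv.ofBijective f (Finite.injective_iff_bijective.1 hf), fun u => by simpa using hfE u⟩

/-- The edge set of the digraph with all edges reversed. -/
abbrev reverseEdges {n : ℕ} (E : Finset (Fin n × Fin n)) : Finset (Fin n × Fin n) :=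
  E.map (Equiv.prodComm (Fin n) (Fin n)).toEmbedding

lemma mem_reverseEdges {n : ℕ} {E : Finset (Fin n × Fin n)} {u v : Fin n} :
    (u, v) ∈ reverseEdges E ↔ (v, u) ∈ E := by
  simp [reverseEdges]

lemma reverseEdges_reverseEdges {n : ℕ} (E : Finset (Fin n × Fin n)) :
    reverseEdges (reverseEdges E) = E := by
  ext ⟨u, v⟩; simp only [mem_reverseEdges]

lemma card_compl_leftNbhd {n : ℕ} {E : Finset (Fin n × Fin n)} {I : Finset (Fin n)}
    (h : (leftNbhd n E I).card < I.card) :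
    (leftNbhd n (reverseEdges E) (leftNbhd n E I)ᶜ).card < ((leftNbhd n E I)ᶜ).card := by
  have hsub : leftNbhd n (reverseEdges E) (leftNbhd n E I)ᶜ ⊆ Iᶜ := by
    intro u hu
    simp only [leftNbhd, mem_filter, mem_univ, true_and, mem_compl, mem_reverseEdges] at hu ⊢
    obtain ⟨v, hv, hE⟩ := hu
    exact fun hI => hv ⟨u, hI, hE⟩
  have h1 := card_le_card hsub
  have h2 := card_le_univ I
  have h3 := card_le_univ (leftNbhd n E I)
  rw [card_compl] at h1 ⊢
  omega

lemma hasObstruction_of_minimal {n : ℕ} {E : Finset (Fin n × Fin n)}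
    (hrow : ∀ u, ∃ v, (u, v) ∈ E) {I : Finset (Fin n)}
    (hI : (leftNbhd n E I).card < I.card)
    (hmin : ∀ I', (leftNbhd n E I').card < I'.card → I.card ≤ I'.card)
    (hmin' : ∀ I', (leftNbhd n (reverseEdges E) I').card < I'.card → I.card ≤ I'.card) :
    ∃ k, 2 ≤ k ∧ 2 * k ≤ n + 1 ∧ HasObstruction E k := by
  have herase : ∀ u ∈ I, I.card - 1 ≤ (leftNbhd n E (I.erase u)).card := by
    intro u hu
    by_contra! hlt
    have h1 := hmin (I.erase u) (by rwa [card_erase_of_mem hu])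
    rw [card_erase_of_mem hu] at h1
    omega
  have hmono : ∀ u, leftNbhd n E (I.erase u) ⊆ leftNbhd n E I := by
    intro u v hv
    simp only [leftNbhd, mem_filter, mem_univ, true_and] at hv ⊢
    obtain ⟨x, hx, hE⟩ := hv
    exact ⟨x, mem_of_mem_erase hx, hE⟩
  obtain ⟨u₀, hu₀⟩ : I.Nonempty := card_pos.1 (by omega)
  have hcard : (leftNbhd n E I).card + 1 = I.card := by
    have h1 := herase u₀ hu₀
    have h2 := card_le_card (hmono u₀)
    omega
  refine ⟨I.card, ?_, ?_, I, leftNbhd n E I, rfl, hcard, ?_, ?_⟩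
  · obtain ⟨v, hv⟩ := hrow u₀
    have : 0 < (leftNbhd n E I).card :=
      card_pos.2 ⟨v, by simpa [leftNbhd] using ⟨u₀, hu₀, hv⟩⟩
    omega
  · have h1 := hmin' _ (card_compl_leftNbhd hI)
    have h2 := card_le_univ (leftNbhd n E I)
    rw [card_compl, Fintype.card_fin] at h1
    rw [Fintype.card_fin] at h2
    omega
  · intro v hv
    rw [Finset.disjoint_left]
    intro u hu huI
    exact hv (by simpa [leftNbhd] using ⟨u, huI, mem_inNbhd.1 hu⟩)
  · intro v hv
    obtain ⟨u, hu, hE⟩ : ∃ u ∈ I, (u, v) ∈ E := by simpa [leftNbhd] using hv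
    by_contra! hc
    have hsub : leftNbhd n E (I.erase u) ⊆ (leftNbhd n E I).erase v := by
      intro v' hv'
      refine mem_erase.2 ⟨?_, hmono u hv'⟩
      rintro rfl
      obtain ⟨u', hu', hE'⟩ : ∃ u' ∈ I.erase u, (u', v') ∈ E := by
        simpa only [leftNbhd, mem_filter, mem_univ, true_and] using hv'
      exact hc u hu u' (mem_of_mem_erase hu') (ne_of_mem_erase hu').symm hE hE'
    have h1 := card_le_card hsub
    have h2 := herase u hu
    rw [card_erase_of_mem hv] at h1
    have : 0 < (leftNbhd n E I).card := card_pos.2 ⟨v, hv⟩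
    omega

lemma exists_hasObstruction {n : ℕ} {E : Finset (Fin n × Fin n)}
    (h : ¬ HasHamiltonianDecomposition n E)
    (hrow : ∀ u, ∃ v, (u, v) ∈ E) (hcol : ∀ v, ∃ u, (u, v) ∈ E) :
    ∃ k, 2 ≤ k ∧ 2 * k ≤ n + 1 ∧ (HasObstruction E k ∨ HasObstruction (reverseEdges E) k) := by
  classical
  obtain ⟨I₀, hI₀⟩ := exists_deficient h
  have hex : ∃ k, ∃ I : Finset (Fin n), I.card = k ∧ ((leftNbhd n E I).card < I.card ∨
      (leftNbhd n (reverseEdges E) I).card < I.card) := ⟨_, I₀, rfl, .inl hI₀⟩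
  obtain ⟨I, hIk, hI⟩ := Nat.find_spec hex
  have hmin : ∀ I' : Finset (Fin n), ((leftNbhd n E I').card < I'.card ∨
      (leftNbhd n (reverseEdges E) I').card < I'.card) → I.card ≤ I'.card := fun I' hI' => by
    rw [hIk]; exact Nat.find_min' hex ⟨I', rfl, hI'⟩
  rcases hI with hI | hI
  · obtain ⟨k, h2, hn, hk⟩ := hasObstruction_of_minimal hrow hI (fun I' h' => hmin I' (.inl h'))
      fun I' h' => hmin I' (.inr h')
    exact ⟨k, h2, hn, .inl hk⟩
  · obtain ⟨k, h2, hn, hk⟩ := hasObstruction_of_minimal (E := reverseEdges E)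
      (fun u => by simpa only [mem_reverseEdges] using hcol u) hI
      (fun I' h' => hmin I' (.inr h'))
      fun I' h' => hmin I' (.inl (by rwa [reverseEdges_reverseEdges] at h'))
    exact ⟨k, h2, hn, .inr hk⟩

end Obstruction

section ObstructionProbability

/-- The edge probabilities of the model `G(n, p, q)`. -/
def edgeProb (n : ℕ) (p q : ℝ) (e : Fin n × Fin n) : ℝ := if e.1 = e.2 then q else p

lemma edgeProb_mem {n : ℕ} {p q : ℝ} (hp : p ∈ Set.Icc (0 : ℝ) 1) (hq : q ∈ Set.Icc (0 : ℝ) 1)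
    (e : Fin n × Fin n) : edgeProb n p q e ∈ Set.Icc (0 : ℝ) 1 := by
  unfold edgeProb; split_ifs <;> assumption

lemma prod_one_sub_edgeProb_le {n : ℕ} {p q : ℝ} (hp : p ∈ Set.Icc (0 : ℝ) 1)
    (hq : q ∈ Set.Icc (0 : ℝ) 1) (I : Finset (Fin n)) (v : Fin n) :
    ∏ u ∈ I, (1 - edgeProb n p q (u, v)) ≤
      Real.exp (-(p * I.card - if v ∈ I then p else 0)) := by
  have hsum : ∑ u ∈ I, -(p - if u = v then p else 0) =
      -(p * I.card - if v ∈ I then p else 0) := by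
    rw [sum_neg_distrib, sum_sub_distrib, sum_const, nsmul_eq_mul, sum_ite_eq', mul_comm]
  rw [← hsum, Real.exp_sum]
  refine prod_le_prod (fun u _ => sub_nonneg.2 (edgeProb_mem hp hq _).2) fun u _ => ?_
  unfold edgeProb
  dsimp only
  split_ifs with h
  · simp [hq.1]
  · rw [sub_zero]
    exact Real.one_sub_le_exp_neg p

/-- An upper bound for the probability that column `v` meets `I` at least twice. -/
def pairBound {n : ℕ} (p : ℝ) (I : Finset (Fin n)) (v : Fin n) : ℝ :=
  if v ∈ I then I.card * p else (I.card * p) ^ 2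

lemma pairBound_nonneg {n : ℕ} {p : ℝ} (hp : 0 ≤ p) (I : Finset (Fin n)) (v : Fin n) :
    0 ≤ pairBound p I v := by
  unfold pairBound; split_ifs <;> positivity

lemma sum_bernoulliWeight_mul_pair_le {n : ℕ} {p q : ℝ} (hp : p ∈ Set.Icc (0 : ℝ) 1)
    (hq : q ∈ Set.Icc (0 : ℝ) 1) (I : Finset (Fin n)) (v : Fin n) :
    ∑ A, bernoulliWeight (fun u => edgeProb n p q (u, v)) A *
      (if ∃ u ∈ I, ∃ u' ∈ I, u ≠ u' ∧ u ∈ A ∧ u' ∈ A then 1 else 0) ≤ pairBound p I v := by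
  have hw := fun A => bernoulliWeight_nonneg (w := fun u => edgeProb n p q (u, v))
    (fun u => edgeProb_mem hp hq _) A
  by_cases hv : v ∈ I
  · calc _ ≤ ∑ A, bernoulliWeight (fun u => edgeProb n p q (u, v)) A *
          ∑ u ∈ I.erase v, (if {u} ⊆ A then 1 else 0) := by
          refine sum_le_sum fun A _ => mul_le_mul_of_nonneg_left ?_ (hw A)
          have hnn : ∀ u ∈ I.erase v, (0 : ℝ) ≤ if {u} ⊆ A then 1 else 0 := fun u _ => by
            split_ifs <;> norm_num
          split_ifs with h
          · obtain ⟨u, hu, u', hu', hne, hA, hA'⟩ := h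
            by_cases huv : u = v
            · have := single_le_sum hnn (mem_erase.2 ⟨fun h => hne (huv.trans h.symm), hu'⟩)
              simpa [hA'] using this
            · have := single_le_sum hnn (mem_erase.2 ⟨huv, hu⟩)
              simpa [hA] using this
          · exact sum_nonneg hnn
      _ = ∑ u ∈ I.erase v, p := by
          simp_rw [mul_sum]
          rw [sum_comm]
          refine sum_congr rfl fun u hu => ?_
          rw [sum_bernoulliWeight_mul_subset, prod_singleton, edgeProb, if_neg (ne_of_mem_erase hu)]
      _ ≤ _ := by
          rw [sum_const, nsmul_eq_mul, pairBound, if_pos hv]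
          have := hp.1
          gcongr
          exact erase_subset v I
  · calc _ ≤ ∑ A, bernoulliWeight (fun u => edgeProb n p q (u, v)) A *
          ∑ x ∈ I.offDiag, (if {x.1, x.2} ⊆ A then 1 else 0) := by
          refine sum_le_sum fun A _ => mul_le_mul_of_nonneg_left ?_ (hw A)
          have hnn : ∀ x ∈ I.offDiag, (0 : ℝ) ≤ if {x.1, x.2} ⊆ A then 1 else 0 := fun u _ => by
            split_ifs <;> norm_num
          split_ifs with h
          · obtain ⟨u, hu, u', hu', hne, hA, hA'⟩ := h
            have := single_le_sum hnn (mem_offDiag.2 ⟨hu, hu', hne⟩ : (u, u') ∈ I.offDiag)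
            simpa [hA', hA, insert_subset_iff] using this
          · exact sum_nonneg hnn
      _ = ∑ x ∈ I.offDiag, p ^ 2 := by
          simp_rw [mul_sum]
          rw [sum_comm]
          refine sum_congr rfl fun x hx => ?_
          obtain ⟨h1, h2, hne⟩ := mem_offDiag.1 hx
          rw [sum_bernoulliWeight_mul_subset, prod_pair hne, edgeProb, edgeProb, if_neg, if_neg, sq]
          · exact fun h => hv ((show x.2 = v from h) ▸ h2)
          · exact fun h => hv ((show x.1 = v from h) ▸ h1)
      _ ≤ _ := by
          rw [sum_const, nsmul_eq_mul, pairBound, if_neg hv, mul_pow]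
          gcongr
          rw [offDiag_card, sq]
          exact_mod_cast Nat.sub_le _ _

open Classical in
lemma sum_bernoulliWeight_mul_isObstruction_le {n : ℕ} {p q : ℝ} (hp : p ∈ Set.Icc (0 : ℝ) 1)
    (hq : q ∈ Set.Icc (0 : ℝ) 1) {I J : Finset (Fin n)} (hIJ : J.card + 1 = I.card) :
    ∑ E, bernoulliWeight (edgeProb n p q) E * (if IsObstruction E I J then 1 else 0) ≤
      Real.exp (-(p * I.card * (n - I.card))) * ∏ v ∈ J, pairBound p I v := by
  let f : Fin n → Finset (Fin n) → ℝ := fun v A =>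
    if v ∈ J then (if ∃ u ∈ I, ∃ u' ∈ I, u ≠ u' ∧ u ∈ A ∧ u' ∈ A then 1 else 0)
    else (if Disjoint A I then 1 else 0)
  have hf : ∀ E : Finset (Fin n × Fin n),
      (if IsObstruction E I J then 1 else 0 : ℝ) = ∏ v, f v (inNbhd E v) := by
    intro E
    have : ∀ v, f v (inNbhd E v) = if (v ∉ J → Disjoint (inNbhd E v) I) ∧
        (v ∈ J → ∃ u ∈ I, ∃ u' ∈ I, u ≠ u' ∧ (u, v) ∈ E ∧ (u', v) ∈ E) then 1 else 0 := by
      intro v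
      by_cases hv : v ∈ J <;> simp [f, hv]
    simp_rw [this]
    rw [prod_boole]
    congr 1
    simp only [IsObstruction, mem_univ, forall_const, forall_and]
  simp_rw [hf]
  rw [sum_bernoulliWeight_mul_prod_inNbhd]
  have hcol0 : ∀ v, 0 ≤ ∑ A, bernoulliWeight (fun u => edgeProb n p q (u, v)) A * f v A := by
    intro v
    refine sum_nonneg fun A _ => mul_nonneg
      (bernoulliWeight_nonneg (fun u => edgeProb_mem hp hq _) A) ?_
    simp only [f]
    split_ifs <;> norm_num
  have hcolJ : ∀ v ∈ J, ∑ A, bernoulliWeight (fun u => edgeProb n p q (u, v)) A * f v A ≤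
      pairBound p I v := by
    intro v hv
    simp only [f, if_pos hv]
    convert sum_bernoulliWeight_mul_pair_le hp hq I v
  have hcol : ∀ v ∈ univ \ J, ∑ A, bernoulliWeight (fun u => edgeProb n p q (u, v)) A * f v A ≤
      Real.exp (-(p * I.card - if v ∈ I then p else 0)) := by
    intro v hv
    simp only [f, if_neg (mem_sdiff.1 hv).2]
    rw [sum_bernoulliWeight_mul_disjoint]
    exact prod_one_sub_edgeProb_le hp hq I v
  rw [← prod_sdiff (subset_univ J)]
  refine mul_le_mul ((prod_le_prod (fun v _ => hcol0 v) hcol).trans ?_)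
    (prod_le_prod (fun v _ => hcol0 v) hcolJ) (prod_nonneg fun v _ => hcol0 v)
    (Real.exp_pos _).le
  rw [← Real.exp_sum, Real.exp_le_exp, sum_neg_distrib, sum_sub_distrib, sum_const, nsmul_eq_mul,
    ← sum_filter, sum_const, nsmul_eq_mul, neg_le_neg_iff]
  have h1 : ((univ \ J).card : ℝ) = n - I.card + 1 := by
    rw [← compl_eq_univ_sdiff, card_compl, Fintype.card_fin,
      Nat.cast_sub (by simpa using card_le_univ J), ← hIJ]
    push_cast; ring
  have h2 : (((univ \ J).filter (· ∈ I)).card : ℝ) ≤ I.card := by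
    exact_mod_cast card_le_card fun v hv => (mem_filter.1 hv).2
  rw [h1]
  nlinarith [mul_le_mul_of_nonneg_right h2 hp.1]

lemma sum_powersetCard_prod_le {α : Type*} [Fintype α] [DecidableEq α] {b : α → ℝ}
    (hb : ∀ a, 0 ≤ b a) {t : ℝ} (ht : 0 < t) (m : ℕ) :
    ∑ J ∈ powersetCard m univ, ∏ a ∈ J, b a ≤ t ^ m * Real.exp ((∑ a, b a) / t) := by
  have h1 : ∑ J ∈ powersetCard m univ, ∏ a ∈ J, (b a / t) ≤ Real.exp ((∑ a, b a) / t) := by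
    calc _ ≤ ∑ J ∈ (univ : Finset α).powerset, ∏ a ∈ J, (b a / t) := by
          refine sum_le_sum_of_subset_of_nonneg 
            (fun J _ => mem_powerset.2 (subset_univ J)) fun J _ _ => ?_
          exact prod_nonneg fun a _ => div_nonneg (hb a) ht.le
      _ = ∏ a, (1 + b a / t) := by rw [prod_one_add]
      _ ≤ ∏ a, Real.exp (b a / t) := prod_le_prod
          (fun a _ => add_nonneg zero_le_one (div_nonneg (hb a) ht.le)) fun a _ => by
            rw [add_comm]; exact Real.add_one_le_exp _
      _ = _ := by rw [← Real.exp_sum, sum_div]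
  refine le_trans (le_of_eq ?_) (mul_le_mul_of_nonneg_left h1 (pow_nonneg ht.le m))
  rw [mul_sum]
  refine sum_congr rfl fun J hJ => ?_
  rw [prod_div_distrib, prod_const, (mem_powersetCard.1 hJ).2]
  field_simp

lemma sum_pairBound_le {n : ℕ} (p : ℝ) (I : Finset (Fin n)) :
    ∑ v, pairBound p I v ≤ (I.card : ℝ) ^ 2 * (p + n * p ^ 2) := by
  have h : ∀ v, pairBound p I v ≤ (if v ∈ I then I.card * p else 0) + (I.card * p) ^ 2 := by
    intro v
    unfold pairBound
    split_ifs
    · exact le_add_of_nonneg_right (sq_nonneg _)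
    · rw [zero_add]
  refine (sum_le_sum fun v _ => h v).trans (le_of_eq ?_)
  rw [sum_add_distrib, sum_ite_mem, univ_inter, sum_const, sum_const, card_univ, Fintype.card_fin,
    nsmul_eq_mul, nsmul_eq_mul]
  ring

open Classical in
lemma sum_bernoulliWeight_mul_hasObstruction_le {n : ℕ} {p q : ℝ} (hp : p ∈ Set.Icc (0 : ℝ) 1)
    (hp0 : 0 < p) (hq : q ∈ Set.Icc (0 : ℝ) 1) {k : ℕ} (hk : 1 ≤ k) :
    ∑ E, bernoulliWeight (edgeProb n p q) E * (if HasObstruction E k then 1 else 0) ≤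
      n.choose k * (Real.exp (-(p * k * (n - k))) *
        ((k * (p + n * p ^ 2)) ^ (k - 1) * Real.exp k)) := by
  have hw := bernoulliWeight_nonneg (w := edgeProb n p q) (edgeProb_mem hp hq)
  calc _ ≤ ∑ E, bernoulliWeight (edgeProb n p q) E * ∑ I ∈ powersetCard k univ,
        ∑ J ∈ powersetCard (k - 1) univ, (if IsObstruction E I J then 1 else 0) := by
        refine sum_le_sum fun E _ => mul_le_mul_of_nonneg_left ?_ (hw E)
        have hnn : ∀ I J, (0 : ℝ) ≤ if IsObstruction E I J then 1 else 0 := fun I J => by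
          split_ifs <;> norm_num
        split_ifs with h
        · obtain ⟨I, J, hI, hJ, h⟩ := h
          calc (1 : ℝ) = if IsObstruction E I J then 1 else 0 := by rw [if_pos h]
            _ ≤ ∑ J ∈ powersetCard (k - 1) univ, (if IsObstruction E I J then 1 else 0) :=
                single_le_sum (f := fun J => if IsObstruction E I J then (1 : ℝ) else 0)
                  (fun J _ => hnn I J) (mem_powersetCard.2 ⟨subset_univ _, by omega⟩)
            _ ≤ _ := single_le_sum (f := fun I => ∑ J ∈ powersetCard (k - 1) univ,
                  if IsObstruction E I J then (1 : ℝ) else 0)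
                  (fun I _ => sum_nonneg fun J _ => hnn I J)
                  (mem_powersetCard.2 ⟨subset_univ _, hI⟩)
        · exact sum_nonneg fun I _ => sum_nonneg fun J _ => hnn I J
    _ = ∑ I ∈ powersetCard k univ, ∑ J ∈ powersetCard (k - 1) univ,
          ∑ E, bernoulliWeight (edgeProb n p q) E * (if IsObstruction E I J then 1 else 0) := by
        simp_rw [mul_sum]
        rw [sum_comm]
        exact sum_congr rfl fun I _ => sum_comm
    _ ≤ ∑ I ∈ powersetCard k (univ : Finset (Fin n)), (Real.exp (-(p * k * (n - k))) *
        ((k * (p + n * p ^ 2)) ^ (k - 1) * Real.exp k)) := by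
        refine sum_le_sum fun I hI => ?_
        have hIk := (mem_powersetCard.1 hI).2
        calc _ ≤ ∑ J ∈ powersetCard (k - 1) univ,
              Real.exp (-(p * k * (n - k))) * ∏ v ∈ J, pairBound p I v := by
              refine sum_le_sum fun J hJ => ?_
              have hJk := (mem_powersetCard.1 hJ).2
              have := sum_bernoulliWeight_mul_isObstruction_le hp hq (I := I) (J := J) (by omega)
              rwa [hIk] at this
          _ ≤ _ := by
              rw [← mul_sum]
              refine mul_le_mul_of_nonneg_left ?_ (Real.exp_pos _).le
              have hβ : 0 < p + n * p ^ 2 := by positivity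
              have hk0 : (0 : ℝ) < k := by exact_mod_cast hk
              refine (sum_powersetCard_prod_le (pairBound_nonneg hp.1 I)
                (mul_pos hk0 hβ) (k - 1)).trans ?_
              gcongr
              rw [div_le_iff₀ (mul_pos hk0 hβ)]
              refine (sum_pairBound_le p I).trans (le_of_eq ?_)
              rw [hIk]; ring
    _ = _ := by
        rw [sum_const, card_powersetCard, card_univ, Fintype.card_fin, nsmul_eq_mul]

lemma obstruction_bound_le {n k : ℕ} {p : ℝ} (hp : 0 ≤ p) (hn : 15 ≤ n) (hk : 2 ≤ k)
    (hkn : 2 * k ≤ n + 1) :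
    n.choose k * (Real.exp (-(p * k * (n - k))) *
        ((k * (p + n * p ^ 2)) ^ (k - 1) * Real.exp k)) ≤
      n * Real.exp (-(n * p)) *
        ((Real.exp 1 * (1 + n * p)) ^ 2 * Real.exp (-(n * p / 3))) ^ k := by
  have hn' : (15 : ℝ) ≤ n := by exact_mod_cast hn
  have hk' : (2 : ℝ) ≤ k := by exact_mod_cast hk
  have hkn' : 2 * (k : ℝ) ≤ n + 1 := by exact_mod_cast hkn
  have hexp : Real.exp (-(p * k * (n - k))) ≤
      Real.exp (-(n * p)) * Real.exp (-(n * p / 3)) ^ k := by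
    rw [← Real.exp_nat_mul, ← Real.exp_add, Real.exp_le_exp]
    have : (n : ℝ) * k / 3 + n ≤ k * (n - k) := by nlinarith
    nlinarith [mul_le_mul_of_nonneg_left this hp]
  have hchoose : (n.choose k : ℝ) * ((k * (p + n * p ^ 2)) ^ (k - 1) * Real.exp k) ≤
      n * ((Real.exp 1 * (1 + n * p)) ^ 2) ^ k := by
    obtain ⟨m, rfl⟩ : ∃ m, k = m + 1 := ⟨k - 1, by omega⟩
    set κ : ℝ := ((m + 1 : ℕ) : ℝ) with hκ
    have hf : (0 : ℝ) < (m + 1).factorial := by positivity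
    have h1 := Nat.choose_le_pow_div (α := ℝ) (m + 1) n
    have h2 := Real.pow_div_factorial_le_exp κ (by positivity) (m + 1)
    have h3 : κ ^ m / (m + 1).factorial ≤ Real.exp κ := by
      refine le_trans ?_ h2
      gcongr
      · linarith
      · omega
    calc _ ≤ (n : ℝ) ^ (m + 1) / (m + 1).factorial *
          ((κ * (p + n * p ^ 2)) ^ m * Real.exp κ) := by
          rw [Nat.add_sub_cancel]; gcongr
      _ = n * ((n * p + (n * p) ^ 2) ^ m * (κ ^ m / (m + 1).factorial) * Real.exp κ) := by
          rw [show (n : ℝ) * p + (n * p) ^ 2 = n * (p + n * p ^ 2) by ring, mul_pow, mul_pow]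
          ring
      _ ≤ n * (((1 + n * p) ^ 2) ^ (m + 1) * Real.exp κ * Real.exp κ) := by
          have h4 : (n * p + (n * p) ^ 2) ^ m ≤ ((1 + n * p) ^ 2) ^ (m + 1) := by
            have : 0 ≤ n * p := by positivity
            calc _ ≤ ((1 + n * p) ^ 2) ^ m := by gcongr; nlinarith
              _ ≤ _ := pow_le_pow_right₀ (by nlinarith) (by omega)
          gcongr
      _ = _ := by
          have : Real.exp κ = Real.exp 1 ^ (m + 1) := by rw [← Real.exp_nat_mul, mul_one]
          rw [this, mul_pow (Real.exp 1) _ 2, mul_pow (Real.exp 1 ^ 2)]; ring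
  calc _ = Real.exp (-(p * k * (n - k))) *
        (n.choose k * ((k * (p + n * p ^ 2)) ^ (k - 1) * Real.exp k)) := by ring
    _ ≤ (Real.exp (-(n * p)) * Real.exp (-(n * p / 3)) ^ k) *
        (n * ((Real.exp 1 * (1 + n * p)) ^ 2) ^ k) := by
        gcongr
    _ = _ := by rw [mul_pow _ (Real.exp (-(n * p / 3)))]; ring

end ObstructionProbability

section EmptyRowsAndColumns

/-- Every vertex has an out-neighbour and an in-neighbour. -/
def NoEmptyRowOrColumn {n : ℕ} (E : Finset (Fin n × Fin n)) : Prop :=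
  (∀ u, ∃ v, (u, v) ∈ E) ∧ ∀ v, ∃ u, (u, v) ∈ E

open Classical in
lemma indicator_noEmptyRowOrColumn {n : ℕ} (E : Finset (Fin n × Fin n)) :
    (if NoEmptyRowOrColumn E then 1 else 0 : ℝ) = ∑ S : Finset (Fin n), (-1) ^ S.card *
      ∏ v, ((if Disjoint (inNbhd E v) S then 1 else 0) -
        (if Disjoint (inNbhd E v) univ then 1 else 0)) := by
  have hcol : ∀ S : Finset (Fin n), ∏ v, ((if Disjoint (inNbhd E v) S then (1 : ℝ) else 0) -
      (if Disjoint (inNbhd E v) univ then 1 else 0)) =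
      (∏ u ∈ S, if ∀ v, (u, v) ∉ E then 1 else 0) * if ∀ v, ∃ u, (u, v) ∈ E then 1 else 0 := by
    intro S
    have h : ∀ v, (if Disjoint (inNbhd E v) S then (1 : ℝ) else 0) -
        (if Disjoint (inNbhd E v) univ then 1 else 0) =
        if Disjoint (inNbhd E v) S ∧ ∃ u, (u, v) ∈ E then 1 else 0 := by
      intro v
      have huniv : Disjoint (inNbhd E v) univ ↔ ¬ ∃ u, (u, v) ∈ E := by
        simp [Finset.disjoint_left]
      by_cases h1 : ∃ u, (u, v) ∈ E
      · simp [huniv, h1]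
      · have h2 : Disjoint (inNbhd E v) S := disjoint_of_subset_right (subset_univ S) (huniv.2 h1)
        simp [huniv, h1, h2]
    simp_rw [h]
    rw [prod_boole, prod_boole, ite_zero_mul_ite_zero, one_mul]
    congr 1
    simp only [mem_univ, forall_const, forall_and, Finset.disjoint_left, mem_inNbhd, eq_iff_iff]
    exact and_congr_left fun _ => ⟨fun h u hu v hE => h v hE hu, fun h v u hE hu => h u hu v hE⟩
  simp_rw [hcol]
  have hrow : ∏ u, (1 - if ∀ v, (u, v) ∉ E then (1 : ℝ) else 0) =
      if ∀ u, ∃ v, (u, v) ∈ E then 1 else 0 := by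
    trans ∏ u, if ∃ v, (u, v) ∈ E then (1 : ℝ) else 0
    swap
    · rw [prod_boole]; simp only [mem_univ, forall_const]
    refine prod_congr rfl fun u _ => ?_
    by_cases h : ∃ v, (u, v) ∈ E
    · rw [if_neg (by simpa using h), if_pos h, sub_zero]
    · rw [if_pos (by simpa using h), if_neg h, sub_self]
  have hexpand := Fintype.prod_add (fun u => -(if ∀ v, (u, v) ∉ E then (1 : ℝ) else 0)) fun _ => 1
  simp only [neg_add_eq_sub, hrow, prod_const_one, mul_one, prod_neg] at hexpand
  simp_rw [← mul_assoc, ← sum_mul, ← hexpand]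
  rw [ite_zero_mul_ite_zero, one_mul]
  exact if_congr Iff.rfl rfl rfl

lemma prod_one_sub_edgeProb {n : ℕ} (p q : ℝ) (S : Finset (Fin n)) (v : Fin n) :
    ∏ u ∈ S, (1 - edgeProb n p q (u, v)) =
      if v ∈ S then (1 - q) * (1 - p) ^ (S.card - 1) else (1 - p) ^ S.card := by
  split_ifs with hv
  · rw [← mul_prod_erase S _ hv, ← card_erase_of_mem hv]
    congr 1
    · simp [edgeProb]
    · exact prod_eq_pow_card fun u hu => by simp [edgeProb, ne_of_mem_erase hu]
  · refine prod_eq_pow_card fun u hu => ?_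
    have : u ≠ v := fun h => hv (h ▸ hu)
    simp [edgeProb, this]

/-- The summand of order `s` in the inclusion-exclusion formula over empty rows. -/
def rowTerm (n : ℕ) (p q : ℝ) (s : ℕ) : ℝ :=
  n.choose s * (-((1 - q) * (1 - p) ^ (n - 1))) ^ s *
    ((1 - (1 - p) ^ (n - s)) ^ s * (1 - (1 - q) * (1 - p) ^ (n - s - 1)) ^ (n - s))

open Classical in
lemma sum_bernoulliWeight_mul_noEmptyRowOrColumn (n : ℕ) (p q : ℝ) :
    ∑ E : Finset (Fin n × Fin n), bernoulliWeight (edgeProb n p q) E *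
      (if NoEmptyRowOrColumn E then 1 else 0) = ∑ s ∈ range (n + 1), rowTerm n p q s := by
  let g : ℕ → ℝ := fun s => (-1) ^ s *
    (((1 - q) * (1 - p) ^ (s - 1) * (1 - (1 - p) ^ (n - s))) ^ s *
      ((1 - p) ^ s * (1 - (1 - q) * (1 - p) ^ (n - s - 1))) ^ (n - s))
  have hS : ∀ S : Finset (Fin n), ∑ E, bernoulliWeight (edgeProb n p q) E *
      ((-1) ^ S.card * ∏ v, ((if Disjoint (inNbhd E v) S then 1 else 0) -
        (if Disjoint (inNbhd E v) univ then 1 else 0))) = g S.card := by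
    intro S
    simp_rw [mul_left_comm _ ((-1 : ℝ) ^ S.card)]
    rw [← mul_sum, sum_bernoulliWeight_mul_prod_inNbhd _ fun v A =>
      (if Disjoint A S then 1 else 0) - (if Disjoint A univ then 1 else 0)]
    congr 1
    simp_rw [mul_sub, sum_sub_distrib, sum_bernoulliWeight_mul_disjoint]
    have hcard : (univ \ S).card = n - S.card := by
      rw [← compl_eq_univ_sdiff, card_compl, Fintype.card_fin]
    rw [← prod_sdiff (subset_univ S), mul_comm]
    congr 1
    · refine prod_eq_pow_card fun v hv => ?_
      rw [← prod_sdiff (subset_univ S), prod_one_sub_edgeProb, prod_one_sub_edgeProb, if_pos hv,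
        if_neg (by simpa using hv), hcard]
      ring
    · rw [← hcard]
      refine prod_eq_pow_card fun v hv => ?_
      rw [← prod_sdiff (subset_univ S), prod_one_sub_edgeProb, prod_one_sub_edgeProb,
        if_neg (mem_sdiff.1 hv).2, if_pos hv]
      ring
  simp_rw [indicator_noEmptyRowOrColumn, mul_sum]
  rw [sum_comm]
  simp_rw [hS]
  rw [← powerset_univ, sum_powerset_apply_card, card_univ, Fintype.card_fin]
  refine sum_congr rfl fun s hs => ?_
  have hsn : s ≤ n := Nat.lt_succ_iff.1 (mem_range.1 hs)
  have hpow : ((1 - p) ^ (s - 1)) ^ s * ((1 - p) ^ s) ^ (n - s) = ((1 - p) ^ (n - 1)) ^ s := by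
    rw [← pow_mul, ← pow_mul, ← pow_mul, ← pow_add]
    congr 1
    rcases Nat.eq_zero_or_pos s with rfl | hs0
    · simp
    · obtain ⟨m, rfl⟩ := Nat.exists_eq_add_of_le hsn
      obtain ⟨j, rfl⟩ := Nat.exists_eq_add_of_le' hs0
      rw [show j + 1 + m - 1 = j + m by omega, Nat.add_sub_cancel_left, Nat.add_sub_cancel]
      ring
  rw [nsmul_eq_mul, rowTerm, neg_pow ((1 - q) * (1 - p) ^ (n - 1)), mul_pow (1 - q), ← hpow]
  simp only [g, mul_pow]
  ring

lemma abs_rowTerm_le {n : ℕ} {p q : ℝ} (hp : p ∈ Set.Icc (0 : ℝ) 1) (hq : q ∈ Set.Icc (0 : ℝ) 1)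
    (s : ℕ) : |rowTerm n p q s| ≤ (n * (1 - p) ^ (n - 1)) ^ s / s.factorial := by
  have hp' : 1 - p ∈ Set.Icc (0 : ℝ) 1 := ⟨sub_nonneg.2 hp.2, sub_le_self _ hp.1⟩
  have hq' : 1 - q ∈ Set.Icc (0 : ℝ) 1 := ⟨sub_nonneg.2 hq.2, sub_le_self _ hq.1⟩
  have hpow : ∀ m, (1 - p) ^ m ∈ Set.Icc (0 : ℝ) 1 := fun m =>
    ⟨pow_nonneg hp'.1 m, pow_le_one₀ hp'.1 hp'.2⟩
  have hqpow : ∀ m, (1 - q) * (1 - p) ^ m ∈ Set.Icc (0 : ℝ) 1 := fun m =>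
    ⟨mul_nonneg hq'.1 (hpow m).1, mul_le_one₀ hq'.2 (hpow m).1 (hpow m).2⟩
  have h1 : |(1 - (1 - p) ^ (n - s)) ^ s| ≤ 1 := by
    rw [abs_pow]
    exact pow_le_one₀ (abs_nonneg _) (abs_le.2 (by
      constructor <;> linarith [(hpow (n - s)).1, (hpow (n - s)).2]))
  have h2 : |(1 - (1 - q) * (1 - p) ^ (n - s - 1)) ^ (n - s)| ≤ 1 := by
    rw [abs_pow]
    exact pow_le_one₀ (abs_nonneg _) (abs_le.2 (by
      constructor <;> linarith [(hqpow (n - s - 1)).1, (hqpow (n - s - 1)).2]))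
  rw [rowTerm, abs_mul, abs_mul, abs_mul, abs_pow, abs_neg, Nat.abs_cast,
    abs_of_nonneg (hqpow (n - 1)).1]
  calc _ ≤ (n : ℝ) ^ s / s.factorial * ((1 - p) ^ (n - 1)) ^ s * (1 * 1) := by
        have h3 := (hqpow (n - 1)).1
        have h4 := (hpow (n - 1)).1
        gcongr
        · exact Nat.choose_le_pow_div s n
        · exact mul_le_of_le_one_left h4 hq'.2
    _ = _ := by rw [mul_pow]; ring

end EmptyRowsAndColumns

section Asymptotics

variable {c : ℝ} {p : ℕ → ℝ}

lemma tendsto_nat_mul_atTop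
    (hlim : Tendsto (fun n : ℕ => (n : ℝ) * p n - Real.log n) atTop (nhds c)) :
    Tendsto (fun n : ℕ => (n : ℝ) * p n) atTop atTop := by
  have := hlim.add_atTop (Real.tendsto_log_atTop.comp tendsto_natCast_atTop_atTop)
  refine this.congr fun n => ?_
  simp

lemma tendsto_nat_mul_sq
    (hlim : Tendsto (fun n : ℕ => (n : ℝ) * p n - Real.log n) atTop (nhds c)) :
    Tendsto (fun n : ℕ => (n : ℝ) * p n ^ 2) atTop (nhds 0) := by
  have hlog : ∀ k : ℕ, Tendsto (fun n : ℕ => Real.log n ^ k / n) atTop (nhds 0) := fun k =>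
    (Real.isLittleO_pow_log_id_atTop (n := k)).tendsto_div_nhds_zero.comp
      tendsto_natCast_atTop_atTop
  have h := ((hlim.pow 2).mul (hlog 0)).add (((hlim.const_mul 2).mul (hlog 1)).add (hlog 2))
  simp only [mul_zero, add_zero] at h
  refine h.congr' ?_
  filter_upwards [eventually_gt_atTop 0] with n hn
  have : (n : ℝ) ≠ 0 := by positivity
  field_simp
  ring

lemma tendsto_prob_zero
    (hlim : Tendsto (fun n : ℕ => (n : ℝ) * p n - Real.log n) atTop (nhds c)) :
    Tendsto p atTop (nhds 0) := by
  have hlog : ∀ k : ℕ, Tendsto (fun n : ℕ => Real.log n ^ k / n) atTop (nhds 0) := fun k =>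
    (Real.isLittleO_pow_log_id_atTop (n := k)).tendsto_div_nhds_zero.comp
      tendsto_natCast_atTop_atTop
  have h := (hlim.mul (hlog 0)).add (hlog 1)
  simp only [mul_zero, add_zero] at h
  refine h.congr' ?_
  filter_upwards [eventually_gt_atTop 0] with n hn
  have : (n : ℝ) ≠ 0 := by positivity
  field_simp
  ring

lemma tendsto_nat_mul_exp_neg
    (hlim : Tendsto (fun n : ℕ => (n : ℝ) * p n - Real.log n) atTop (nhds c)) :
    Tendsto (fun n : ℕ => (n : ℝ) * Real.exp (-(n * p n))) atTop (nhds (Real.exp (-c))) := by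
  refine ((Real.continuous_exp.tendsto _).comp hlim.neg).congr' ?_
  filter_upwards [eventually_gt_atTop 0] with n hn
  have : (0 : ℝ) < n := by positivity
  simp only [Function.comp]
  rw [neg_sub, sub_eq_add_neg, Real.exp_add, Real.exp_log this]

lemma tendsto_nat_mul_one_sub_pow
    (hlim : Tendsto (fun n : ℕ => (n : ℝ) * p n - Real.log n) atTop (nhds c)) :
    Tendsto (fun n : ℕ => (n : ℝ) * (1 - p n) ^ n) atTop (nhds (Real.exp (-c))) := by
  have hp0 := tendsto_prob_zero hlim
  have hlt : ∀ᶠ n in atTop, p n < 1 := hp0.eventually (gt_mem_nhds one_pos)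
  have hsq : Tendsto (fun n : ℕ => Real.exp (-(n * p n ^ 2 / (1 - p n)))) atTop (nhds 1) := by
    have h1 : Tendsto (fun n => 1 - p n) atTop (nhds 1) := by simpa using hp0.const_sub 1
    have h := ((tendsto_nat_mul_sq hlim).div h1 one_ne_zero).neg
    simpa [Function.comp_def] using (Real.continuous_exp.tendsto _).comp h
  have hexp := tendsto_nat_mul_exp_neg hlim
  refine tendsto_of_tendsto_of_tendsto_of_le_of_le' (by simpa using hexp.mul hsq) hexp ?_ ?_
  · filter_upwards [hlt] with n hn
    have h0 : 0 < 1 - p n := sub_pos.2 hn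
    rw [mul_assoc, ← Real.exp_add]
    refine mul_le_mul_of_nonneg_left ?_ (Nat.cast_nonneg n)
    rw [← Real.exp_log (pow_pos h0 n), Real.exp_le_exp, Real.log_pow]
    have h1 := mul_le_mul_of_nonneg_left (Real.one_sub_inv_le_log_of_pos h0)
      (Nat.cast_nonneg (α := ℝ) n)
    refine le_trans (le_of_eq ?_) h1
    field_simp
    ring
  · filter_upwards [hlt] with n hn
    refine mul_le_mul_of_nonneg_left ?_ (Nat.cast_nonneg n)
    rw [← mul_neg, Real.exp_nat_mul]
    exact pow_le_pow_left₀ (sub_pos.2 hn).le (Real.one_sub_le_exp_neg _) n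

lemma tendsto_nat_mul_one_sub_pow_sub
    (hlim : Tendsto (fun n : ℕ => (n : ℝ) * p n - Real.log n) atTop (nhds c)) (j : ℕ) :
    Tendsto (fun n : ℕ => (n : ℝ) * (1 - p n) ^ (n - j)) atTop (nhds (Real.exp (-c))) := by
  have hp0 := tendsto_prob_zero hlim
  have h1 : Tendsto (fun n => (1 - p n) ^ j) atTop (nhds 1) := by
    simpa using (hp0.const_sub 1).pow j
  have h := (tendsto_nat_mul_one_sub_pow hlim).div h1 one_ne_zero
  rw [div_one] at h
  refine h.congr' ?_
  filter_upwards [hp0.eventually (gt_mem_nhds one_pos), eventually_ge_atTop j] with n hn hj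
  rw [pow_sub₀ _ (sub_pos.2 hn).ne' hj]
  simp only [Pi.div_apply]
  ring

lemma tendsto_rowTerm (q : ℝ)
    (hlim : Tendsto (fun n : ℕ => (n : ℝ) * p n - Real.log n) atTop (nhds c)) (s : ℕ) :
    Tendsto (fun n => rowTerm n (p n) q s) atTop
      (nhds (Real.exp (-((1 - q) * Real.exp (-c))) *
        ((-((1 - q) * Real.exp (-c))) ^ s / s.factorial))) := by
  have hp0 := tendsto_prob_zero hlim
  have hr : Tendsto (fun n : ℕ => (n : ℝ) * ((1 - q) * (1 - p n) ^ (n - s - 1))) atTop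
      (nhds ((1 - q) * Real.exp (-c))) := by
    refine ((tendsto_nat_mul_one_sub_pow_sub hlim (s + 1)).const_mul (1 - q)).congr fun n => ?_
    rw [Nat.sub_sub]; ring
  have h1 := ProbabilityTheory.tendsto_choose_mul_pow_of_tendsto_mul_atTop s hr
  have h2 : Tendsto (fun n => (1 - p n) ^ (s * s)) atTop (nhds 1) := by
    simpa using (hp0.const_sub 1).pow (s * s)
  have h3 : Tendsto (fun n => (1 - (1 - p n) ^ (n - s)) ^ s) atTop (nhds 1) := by
    have := ProbabilityTheory.tendsto_zero_of_tendsto_mul_atTop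
      (tendsto_nat_mul_one_sub_pow_sub hlim s)
    simpa using (this.const_sub 1).pow s
  have h := ((h1.mul h2).mul h3).const_mul ((-1) ^ s)
  have hval : (-1) ^ s * (Real.exp (-((1 - q) * Real.exp (-c))) * ((1 - q) * Real.exp (-c)) ^ s /
      s.factorial * 1 * 1) = Real.exp (-((1 - q) * Real.exp (-c))) *
        ((-((1 - q) * Real.exp (-c))) ^ s / s.factorial) := by
    rw [neg_pow ((1 - q) * Real.exp (-c))]; ring
  rw [hval] at h
  refine h.congr' ?_
  filter_upwards [eventually_ge_atTop (s + 1)] with n hn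
  rw [rowTerm, neg_pow ((1 - q) * (1 - p n) ^ (n - 1)), show n - 1 = (n - s - 1) + s by omega,
    pow_add, pow_mul, ← mul_assoc (1 - q), mul_pow _ ((1 - p n) ^ s)]
  ring

open Classical in
lemma tendsto_noEmptyRowOrColumn {q : ℝ} (hq : q ∈ Set.Icc (0 : ℝ) 1)
    (hp : ∀ n, p n ∈ Set.Icc (0 : ℝ) 1)
    (hlim : Tendsto (fun n : ℕ => (n : ℝ) * p n - Real.log n) atTop (nhds c)) :
    Tendsto (fun n : ℕ => ∑ E : Finset (Fin n × Fin n), bernoulliWeight (edgeProb n (p n) q) E *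
      (if NoEmptyRowOrColumn E then 1 else 0)) atTop
      (nhds (Real.exp (-(2 * (1 - q) * Real.exp (-c))))) := by
  have hsum : HasSum (fun s : ℕ => Real.exp (-((1 - q) * Real.exp (-c))) *
        ((-((1 - q) * Real.exp (-c))) ^ s / s.factorial))
      (Real.exp (-(2 * (1 - q) * Real.exp (-c)))) := by
    have h := (NormedSpace.expSeries_div_hasSum_exp (-((1 - q) * Real.exp (-c)))).mul_left
      (Real.exp (-((1 - q) * Real.exp (-c))))
    rw [← Real.exp_eq_exp_ℝ, ← Real.exp_add] at h
    rwa [show -((1 - q) * Real.exp (-c)) + -((1 - q) * Real.exp (-c)) =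
      -(2 * (1 - q) * Real.exp (-c)) by ring] at h
  rw [← hsum.tsum_eq]
  have hK : ∀ᶠ n : ℕ in atTop, (n : ℝ) * (1 - p n) ^ (n - 1) ≤ Real.exp (-c) + 1 :=
    (tendsto_nat_mul_one_sub_pow_sub hlim 1).eventually (ge_mem_nhds (lt_add_one _))
  have htannery := tendsto_tsum_of_dominated_convergence (𝓕 := atTop)
    (f := fun n s => rowTerm n (p n) q s)
    (Real.summable_pow_div_factorial (Real.exp (-c) + 1)) (tendsto_rowTerm q hlim) (by
      filter_upwards [hK] with n hn s
      refine (abs_rowTerm_le (hp n) hq s).trans ?_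
      have : 0 ≤ 1 - p n := sub_nonneg.2 (hp n).2
      gcongr)
  refine htannery.congr fun n => ?_
  rw [sum_bernoulliWeight_mul_noEmptyRowOrColumn]
  refine tsum_eq_sum fun s hs => ?_
  rw [rowTerm, Nat.choose_eq_zero_of_lt (by simpa using hs)]
  simp

open Classical in
lemma tendsto_noEmptyRowOrColumn_and_not {q : ℝ} (hq : q ∈ Set.Icc (0 : ℝ) 1)
    (hp : ∀ n, p n ∈ Set.Icc (0 : ℝ) 1)
    (hlim : Tendsto (fun n : ℕ => (n : ℝ) * p n - Real.log n) atTop (nhds c)) :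
    Tendsto (fun n : ℕ => ∑ E : Finset (Fin n × Fin n), bernoulliWeight (edgeProb n (p n) q) E *
      (if NoEmptyRowOrColumn E ∧ ¬ HasHamiltonianDecomposition n E then 1 else 0)) atTop
      (nhds 0) := by
  have hm := tendsto_nat_mul_atTop hlim
  let x : ℕ → ℝ := fun n => (Real.exp 1 * (1 + n * p n)) ^ 2 * Real.exp (-(n * p n / 3))
  have hx : Tendsto x atTop (nhds 0) := by
    have hm3 : Tendsto (fun n : ℕ => (n : ℝ) * p n / 3) atTop atTop :=
      hm.atTop_div_const (by norm_num)
    have h := fun k => (Real.tendsto_pow_mul_exp_neg_atTop_nhds_zero k).comp hm3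
    have h' := (((h 0).add ((h 1).const_mul 6)).add ((h 2).const_mul 9)).const_mul (Real.exp 1 ^ 2)
    simp only [mul_zero, add_zero] at h'
    refine h'.congr fun n => ?_
    simp only [Function.comp, x]
    ring
  have hbound : Tendsto (fun n : ℕ => 2 * ((n * Real.exp (-(n * p n))) * (x n ^ 2 / (1 - x n))))
      atTop (nhds 0) := by
    have h1 : Tendsto (fun n => 1 - x n) atTop (nhds 1) := by simpa using hx.const_sub 1
    simpa using (((tendsto_nat_mul_exp_neg hlim).mul ((hx.pow 2).div h1 one_ne_zero)).const_mul 2)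
  refine tendsto_of_tendsto_of_tendsto_of_le_of_le' tendsto_const_nhds hbound
    (Eventually.of_forall fun n => sum_nonneg fun E _ => mul_nonneg
      (bernoulliWeight_nonneg (edgeProb_mem (hp n) hq) E) (by split_ifs <;> norm_num)) ?_
  filter_upwards [hm.eventually_gt_atTop 0, hx.eventually (gt_mem_nhds one_pos),
    eventually_ge_atTop 15] with n hpos hx1 hn
  have hp0 : 0 < p n := pos_of_mul_pos_right hpos (Nat.cast_nonneg n)
  have hx0 : 0 ≤ x n := by positivity
  have hw := bernoulliWeight_nonneg (edgeProb_mem (n := n) (hp n) hq)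
  let K := (Ico 2 (n + 2)).filter fun k => 2 * k ≤ n + 1
  have hprob : ∀ k ∈ K, ∑ E : Finset (Fin n × Fin n), bernoulliWeight (edgeProb n (p n) q) E *
      (if HasObstruction E k then 1 else 0) ≤ n * Real.exp (-(n * p n)) * x n ^ k := by
    intro k hk
    obtain ⟨hk2, hkn⟩ := mem_filter.1 hk
    have hk2 := (mem_Ico.1 hk2).1
    exact (sum_bernoulliWeight_mul_hasObstruction_le (hp n) hp0 hq (by omega)).trans
      (obstruction_bound_le (hp n).1 hn hk2 hkn)
  calc _ ≤ ∑ E : Finset (Fin n × Fin n), bernoulliWeight (edgeProb n (p n) q) E *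
        ∑ k ∈ K, ((if HasObstruction E k then 1 else 0) +
          (if HasObstruction (reverseEdges E) k then 1 else 0)) := by
        refine sum_le_sum fun E _ => mul_le_mul_of_nonneg_left ?_ (hw E)
        have hnn : ∀ k ∈ K, (0 : ℝ) ≤ (if HasObstruction E k then 1 else 0) +
            (if HasObstruction (reverseEdges E) k then 1 else 0) := fun k _ => by
          split_ifs <;> norm_num
        split_ifs with h
        · obtain ⟨k, hk2, hkn, hk⟩ := exists_hasObstruction h.2 h.1.1 h.1.2
          refine le_trans ?_ (single_le_sum hnn
            (mem_filter.2 ⟨mem_Ico.2 ⟨hk2, by omega⟩, hkn⟩ : k ∈ K))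
          rcases hk with hk | hk <;> rw [if_pos hk] <;> split_ifs <;> norm_num
        · exact sum_nonneg hnn
    _ = ∑ k ∈ K, 2 * ∑ E : Finset (Fin n × Fin n), bernoulliWeight (edgeProb n (p n) q) E *
          (if HasObstruction E k then 1 else 0) := by
        simp_rw [mul_sum]
        rw [sum_comm]
        refine sum_congr rfl fun k _ => ?_
        simp_rw [mul_add]
        rw [sum_add_distrib, sum_bernoulliWeight_map_swap (edgeProb n (p n) q)
          (fun e => by simp [edgeProb, eq_comm]) fun E => if HasObstruction E k then 1 else 0,
          ← mul_sum, two_mul]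
    _ ≤ ∑ k ∈ K, 2 * (n * Real.exp (-(n * p n)) * x n ^ k) :=
        sum_le_sum fun k hk => mul_le_mul_of_nonneg_left (hprob k hk) zero_le_two
    _ ≤ ∑ k ∈ Ico 2 (n + 2), 2 * (n * Real.exp (-(n * p n)) * x n ^ k) :=
        sum_le_sum_of_subset_of_nonneg (filter_subset ..) fun k _ _ => by positivity
    _ ≤ _ := by
        simp_rw [← mul_sum]
        gcongr
        exact geom_sum_Ico_le_of_lt_one hx0 hx1

end Asymptotics

lemma HasHamiltonianDecomposition.noEmptyRowOrColumn {n : ℕ} {E : Finset (Fin n × Fin n)}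
    (h : HasHamiltonianDecomposition n E) : NoEmptyRowOrColumn E := by
  obtain ⟨σ, hσ⟩ := h
  exact ⟨fun u => ⟨σ u, hσ u⟩, fun v => ⟨σ.symm v, by simpa using hσ (σ.symm v)⟩⟩

open Classical in
lemma digraphProb_eq_sum (n : ℕ) (p q : ℝ) (A : Set (Finset (Fin n × Fin n))) :
    digraphProb n p q A =
      ∑ E, bernoulliWeight (edgeProb n p q) E * (if E ∈ A then 1 else 0) := by
  refine sum_congr rfl fun E _ => ?_
  rw [Set.indicator_apply, mul_ite, mul_one, mul_zero, bernoulliWeight_eq]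
  congr 2
  refine prod_congr rfl fun e _ => ?_
  unfold edgeProb
  split_ifs <;> rfl

/-- If `n·p_n - log n → c` and `q ∈ [0,1]` is constant, the probability
that a digraph drawn from `G(n, p_n, q)` admits a Hamiltonian decomposition
converges to `exp(-2(1-q)·exp(-c))`. -/
theorem prob_hamiltonianDecomposition_tendsto_selfloop (c : ℝ) (q : ℝ)
    (hq : q ∈ Set.Icc (0 : ℝ) 1) (p : ℕ → ℝ)
    (hp : ∀ n, p n ∈ Set.Icc (0 : ℝ) 1)
    (hlim : Tendsto (fun n : ℕ => (n : ℝ) * p n - Real.log n) atTop (nhds c)) :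
    Tendsto (fun n : ℕ =>
        digraphProb n (p n) q {E | HasHamiltonianDecomposition n E}) atTop
      (nhds (Real.exp (-(2 * (1 - q) * Real.exp (-c))))) := by
  classical
  have h := (tendsto_noEmptyRowOrColumn hq hp hlim).sub
    (tendsto_noEmptyRowOrColumn_and_not hq hp hlim)
  rw [sub_zero] at h
  refine h.congr fun n => ?_
  rw [digraphProb_eq_sum, ← sum_sub_distrib]
  refine sum_congr rfl fun E _ => ?_
  rw [← mul_sub]
  congr 1
  by_cases hE : HasHamiltonianDecomposition n E
  · simp [hE, hE.noEmptyRowOrColumn]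
  · simp [hE]
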